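/- arXiv:2310.05454 — 2 statements merged into one kernel-verified Lean document; each statement's English description precedes it below -/
import Mathlib

section
/- For every cylinder order ≤ on A^∞, L_≤ = M_≤. -/
open scoped Classical

noncomputable section

/-- The ultrametric on infinite words: `d(a,b) = 2^{-min{n ≥ 1 : a_n ≠ b_n}}`
(words are indexed from 0 here, so position `i` corresponds to `n = i+1`). -/
noncomputable def wdist {A : Type*} [DecidableEq A] (a b : ℕ → A) : ℝ :=
  if h : ∃ n, a n ≠ b n then (2 : ℝ)⁻¹ ^ (Nat.find h + 1) else 0

/-- The tail `a_{k+1} a_{k+2} ⋯` of an infinite word. -/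
def shiftn {A : Type*} (a : ℕ → A) (k : ℕ) : ℕ → A := fun n => a (n + k)

/-- The set of tails of an infinite word (including the word itself). -/
def tails {A : Type*} (a : ℕ → A) : Set (ℕ → A) := {b | ∃ k, b = shiftn a k}

/-- A cylinder order: a total order such that `a ≤ b ≤ c` implies `d(a,b) ≤ d(a,c)`. -/
def IsCylOrder {A : Type*} [DecidableEq A] (le : (ℕ → A) → (ℕ → A) → Prop) : Prop :=
  (∀ a b, le a b ∨ le b a) ∧
  (∀ a b, le a b → le b a → a = b) ∧
  (∀ a b c, le a b → le b c → le a c) ∧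
  (∀ a b c, le a b → le b c → wdist a b ≤ wdist a c)

/-- Strict comparison associated to an order relation. -/
def wlt {A : Type*} (le : (ℕ → A) → (ℕ → A) → Prop) (a b : ℕ → A) : Prop :=
  le a b ∧ a ≠ b

/-- `m` is the least upper bound of the set `s` with respect to `le`. -/
def IsSupOf {A : Type*} (le : (ℕ → A) → (ℕ → A) → Prop) (s : Set (ℕ → A))
    (m : ℕ → A) : Prop :=
  (∀ x ∈ s, le x m) ∧ ∀ b, (∀ x ∈ s, le x b) → le m b

/-- The set `M_≤ = {s_≤(a) : a ∈ A^∞}` of sup-words. -/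
def supWords {A : Type*} (le : (ℕ → A) → (ℕ → A) → Prop) : Set (ℕ → A) :=
  {m | ∃ a, IsSupOf le (tails a) m}

/-- `x` is an accumulation point of `M` in the metric `wdist`. -/
def IsAccPt' {A : Type*} [DecidableEq A] (M : Set (ℕ → A)) (x : ℕ → A) : Prop :=
  ∀ ε : ℝ, 0 < ε → ∃ y ∈ M, y ≠ x ∧ wdist x y < ε

/-- `x` is the smallest (w.r.t. `le`) accumulation point of `M`. -/
def IsSmallestAcc {A : Type*} [DecidableEq A] (le : (ℕ → A) → (ℕ → A) → Prop)
    (M : Set (ℕ → A)) (x : ℕ → A) : Prop :=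
  IsAccPt' M x ∧ ∀ y, IsAccPt' M y → le x y

/-- Membership in the cylinder given by the finite word `w`. -/
def inCyl {A : Type*} (w : List A) (a : ℕ → A) : Prop :=
  ∀ i : Fin w.length, a i.val = w.get i

/-- `[u] < [v]` for cylinders: every element of `[u]` is strictly below every element of `[v]`. -/
def cylLt {A : Type*} (le : (ℕ → A) → (ℕ → A) → Prop) (u v : List A) : Prop :=
  ∀ a b, inCyl u a → inCyl v b → wlt le a b

/-- `m` is the greatest lower bound of the set `s` with respect to `le`. -/
def IsInfOf {A : Type*} (le : (ℕ → A) → (ℕ → A) → Prop) (s : Set (ℕ → A))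
    (m : ℕ → A) : Prop :=
  (∀ x ∈ s, le m x) ∧ ∀ b, (∀ x ∈ s, le b x) → le b m

/-- The tails `a_{k+1} a_{k+2} ⋯` for `k ≥ N`. -/
def tailsFrom {A : Type*} (a : ℕ → A) (N : ℕ) : Set (ℕ → A) :=
  {b | ∃ k, N ≤ k ∧ b = shiftn a k}

/-- `m = ℓ_≤(a) = inf_{N} sup_{n ≥ N} a_n a_{n+1} ⋯`. -/
def IsLimsupOf {A : Type*} (le : (ℕ → A) → (ℕ → A) → Prop) (a m : ℕ → A) : Prop :=
  IsInfOf le {b | ∃ N, IsSupOf le (tailsFrom a N) b} m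

/-- The set `L_≤ = {ℓ_≤(a) : a ∈ A^∞}`. -/
def limsupWords {A : Type*} (le : (ℕ → A) → (ℕ → A) → Prop) : Set (ℕ → A) :=
  {m | ∃ a, IsLimsupOf le a m}

section CylinderOrder

variable {A : Type*}

/-- The ω-limit set of a word: the words all of whose prefixes occur infinitely often in it. -/
def omegaLimitWords (a : ℕ → A) : Set (ℕ → A) :=
  {x | ∀ K N, ∃ k, N ≤ k ∧ ∀ i < K, a (i + k) = x i}

theorem shiftn_mem_omegaLimitWords {a x : ℕ → A} (hx : x ∈ omegaLimitWords a) (j : ℕ) :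
    shiftn x j ∈ omegaLimitWords a := by
  intro K N
  obtain ⟨k, hk, h⟩ := hx (K + j) N
  refine ⟨j + k, by omega, fun i hi => ?_⟩
  rw [← add_assoc]
  exact h (i + j) (by omega)

theorem mem_closure_iff_prefix [TopologicalSpace A] [DiscreteTopology A] {S : Set (ℕ → A)}
    {x : ℕ → A} : x ∈ closure S ↔ ∀ K, ∃ y ∈ S, ∀ i < K, y i = x i := by
  constructor
  · intro hx K
    obtain ⟨y, hy, hyS⟩ := mem_closure_iff.1 hx (PiNat.cylinder x K)
      (PiNat.isOpen_cylinder (fun _ => A) x K) (PiNat.self_mem_cylinder x K)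
    exact ⟨y, hyS, hy⟩
  · intro hx
    rw [(PiNat.isTopologicalBasis_cylinders (fun _ => A)).mem_closure_iff]
    rintro _ ⟨z, n, rfl⟩ hxz
    obtain ⟨y, hyS, hy⟩ := hx n
    exact ⟨y, fun i hi => (hy i hi).trans (hxz i hi), hyS⟩

theorem omegaLimitWords_eq_iInter [TopologicalSpace A] [DiscreteTopology A] (a : ℕ → A) :
    omegaLimitWords a = ⋂ N, closure (tailsFrom a N) := by
  ext x
  simp only [Set.mem_iInter, mem_closure_iff_prefix]
  constructor
  · intro hx N K
    obtain ⟨k, hk, h⟩ := hx K N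
    exact ⟨shiftn a k, ⟨k, hk, rfl⟩, h⟩
  · intro hx K N
    obtain ⟨_, ⟨k, hk, rfl⟩, h⟩ := hx N K
    exact ⟨k, hk, h⟩

/-- A prefix limit of tails is either an actual tail or a member of the ω-limit set. -/
theorem mem_omegaLimitWords_or_eq_shiftn {a x : ℕ → A}
    (hx : ∀ K, ∃ y ∈ tails a, ∀ i < K, y i = x i) :
    x ∈ omegaLimitWords a ∨ ∃ k, x = shiftn a k := by
  by_contra! hcon
  obtain ⟨hω, hne⟩ := hcon
  simp only [omegaLimitWords, Set.mem_ofPred_eq, not_forall, not_exists, not_and] at hω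
  obtain ⟨K, N, hKN⟩ := hω
  have hdiff : ∀ k, ∃ i, a (i + k) ≠ x i := fun k => by
    by_contra! hk
    exact hne k (funext fun i => (hk i).symm)
  choose d hd using hdiff
  obtain ⟨_, ⟨k, rfl⟩, hk⟩ := hx (K + (Finset.range N).sup d + 1)
  rcases lt_or_ge k N with hkN | hkN
  · have : d k ≤ (Finset.range N).sup d := Finset.le_sup (Finset.mem_range.2 hkN)
    exact hd k (hk (d k) (by omega))
  · obtain ⟨i, hi, hia⟩ := hKN k hkN
    exact hia (hk i (by omega))

section Metric

variable [DecidableEq A] {x y : ℕ → A} {n : ℕ}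

theorem wdist_le_of_prefix (h : ∀ i < n, x i = y i) : wdist x y ≤ (2 : ℝ)⁻¹ ^ (n + 1) := by
  unfold wdist
  split_ifs with hne
  · refine pow_le_pow_of_le_one (by norm_num) (by norm_num) (Nat.succ_le_succ ?_)
    exact (Nat.le_find_iff hne n).2 fun i hi => not_not.2 (h i hi)
  · positivity

theorem lt_wdist_of_ne (h : ∃ i < n, x i ≠ y i) : (2 : ℝ)⁻¹ ^ (n + 1) < wdist x y := by
  obtain ⟨i, hi, hxy⟩ := h
  have hne : ∃ i, x i ≠ y i := ⟨i, hxy⟩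
  unfold wdist
  rw [dif_pos hne]
  refine pow_lt_pow_right_of_lt_one₀ (by norm_num) (by norm_num) (Nat.succ_lt_succ ?_)
  exact (Nat.find_min' hne hxy).trans_lt hi

end Metric

section Order

variable [DecidableEq A] {le : (ℕ → A) → (ℕ → A) → Prop}

namespace IsCylOrder

theorem le_refl (h : IsCylOrder le) (x : ℕ → A) : le x x := (h.1 x x).elim id id

theorem le_of_not_le (h : IsCylOrder le) {x y : ℕ → A} (hxy : ¬ le x y) : le y x :=
  (h.1 x y).resolve_left hxy

theorem le_congr_left (h : IsCylOrder le) {x x' y : ℕ → A} {n : ℕ} (hx : ∀ i < n, x i = x' i)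
    (hy : ∃ i < n, x i ≠ y i) (hle : le x y) : le x' y := by
  by_contra hcon
  have h1 := h.2.2.2 x y x' hle (h.le_of_not_le hcon)
  exact absurd h1 (not_le.2 ((wdist_le_of_prefix hx).trans_lt (lt_wdist_of_ne hy)))

theorem le_congr_right (h : IsCylOrder le) {x y y' : ℕ → A} {n : ℕ} (hy : ∀ i < n, y i = y' i)
    (hx : ∃ i < n, y i ≠ x i) (hle : le x y) : le x y' := by
  by_contra hcon
  obtain ⟨i, hi, hne⟩ := hx
  have h1 := h.2.2.2 y' x y (h.le_of_not_le hcon) hle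
  exact absurd h1 (not_le.2 ((wdist_le_of_prefix fun i hi => (hy i hi).symm).trans_lt
    (lt_wdist_of_ne ⟨i, hi, hy i hi ▸ hne⟩)))

theorem isClosed_Iic [TopologicalSpace A] [DiscreteTopology A] (h : IsCylOrder le) (t : ℕ → A) :
    IsClosed {x | le x t} := by
  refine isClosed_of_closure_subset fun x hx => ?_
  by_cases hxt : x = t
  · exact hxt ▸ h.le_refl x
  obtain ⟨i, hi⟩ := Function.ne_iff.1 hxt
  obtain ⟨y, hy, hyx⟩ := mem_closure_iff_prefix.1 hx (i + 1)
  exact h.le_congr_left hyx ⟨i, by omega, hyx i (by omega) ▸ hi⟩ hy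

theorem isClosed_Ici [TopologicalSpace A] [DiscreteTopology A] (h : IsCylOrder le) (t : ℕ → A) :
    IsClosed {x | le t x} := by
  refine isClosed_of_closure_subset fun x hx => ?_
  by_cases hxt : x = t
  · exact hxt ▸ h.le_refl x
  obtain ⟨i, hi⟩ := Function.ne_iff.1 hxt
  obtain ⟨y, hy, hyx⟩ := mem_closure_iff_prefix.1 hx (i + 1)
  exact h.le_congr_right hyx ⟨i, by omega, hyx i (by omega) ▸ hi⟩ hy

theorem isSupOf_unique (h : IsCylOrder le) {S : Set (ℕ → A)} {m m' : ℕ → A}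
    (hm : IsSupOf le S m) (hm' : IsSupOf le S m') : m = m' :=
  h.2.1 _ _ (hm.2 _ hm'.1) (hm'.2 _ hm.1)

theorem le_of_mem_omegaLimitWords (h : IsCylOrder le) {a x s : ℕ → A} {N : ℕ}
    (hx : x ∈ omegaLimitWords a) (hs : ∀ y ∈ tailsFrom a N, le y s) : le x s := by
  let _ : TopologicalSpace A := ⊥
  have : DiscreteTopology A := ⟨rfl⟩
  rw [omegaLimitWords_eq_iInter] at hx
  exact closure_minimal (t := {x | le x s}) hs (h.isClosed_Iic s) (Set.mem_iInter.1 hx N)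

variable [Finite A]

/-- Nonempty sets of words have suprema, and these are prefix limits of the set. -/
theorem exists_isSupOf (h : IsCylOrder le) {S : Set (ℕ → A)} (hS : S.Nonempty) :
    ∃ m, IsSupOf le S m ∧ ∀ K, ∃ y ∈ S, ∀ i < K, y i = m i := by
  let _ : TopologicalSpace A := ⊥
  have : DiscreteTopology A := ⟨rfl⟩
  let _ : LinearOrder (ℕ → A) :=
    { le := le
      le_refl := h.le_refl
      le_trans := h.2.2.1
      le_antisymm := h.2.1
      le_total := h.1
      toDecidableLE := Classical.decRel _ }
  have : ClosedIciTopology (ℕ → A) := ⟨h.isClosed_Ici⟩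
  obtain ⟨m, hmS, hm⟩ :=
    (isClosed_closure (s := S)).isCompact.exists_isGreatest hS.closure
  exact ⟨m, ⟨fun x hx => hm (subset_closure hx),
    fun b hb => closure_minimal (t := {x | le x b}) hb (h.isClosed_Iic b) hmS⟩,
    mem_closure_iff_prefix.1 hmS⟩

theorem exists_isSupOf_tailsFrom (h : IsCylOrder le) (a : ℕ → A) (N : ℕ) :
    ∃ m, IsSupOf le (tailsFrom a N) m ∧ ∀ K, ∃ y ∈ tailsFrom a N, ∀ i < K, y i = m i :=
  h.exists_isSupOf ⟨shiftn a N, N, _root_.le_refl N, rfl⟩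

theorem exists_mem_omegaLimitWords_ge (h : IsCylOrder le) {a c : ℕ → A}
    (hc : ∀ s ∈ {b | ∃ N, IsSupOf le (tailsFrom a N) b}, le c s) :
    ∃ x ∈ omegaLimitWords a, le c x := by
  let _ : TopologicalSpace A := ⊥
  have : DiscreteTopology A := ⟨rfl⟩
  have hclosed : ∀ N, IsClosed (closure (tailsFrom a N) ∩ {x | le c x}) :=
    fun N => isClosed_closure.inter (h.isClosed_Ici c)
  obtain ⟨x, hx⟩ := IsCompact.nonempty_iInter_of_sequence_nonempty_isCompact_isClosed
    (fun N => closure (tailsFrom a N) ∩ {x | le c x})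
    (fun N => Set.inter_subset_inter_left _ (closure_mono
      fun _ ⟨k, hk, hy⟩ => ⟨k, (Nat.le_succ N).trans hk, hy⟩))
    (fun N => by
      obtain ⟨s, hs, hsc⟩ := h.exists_isSupOf_tailsFrom a N
      exact ⟨s, mem_closure_iff_prefix.2 hsc, hc s ⟨N, hs⟩⟩)
    (hclosed 0).isCompact hclosed
  rw [Set.mem_iInter] at hx
  refine ⟨x, ?_, (hx 0).2⟩
  rw [omegaLimitWords_eq_iInter]
  exact Set.mem_iInter.2 fun N => (hx N).1

/-- The limsup of the tails is the greatest element of the ω-limit set. -/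
theorem isLimsupOf_iff (h : IsCylOrder le) {a m : ℕ → A} :
    IsLimsupOf le a m ↔ m ∈ omegaLimitWords a ∧ ∀ x ∈ omegaLimitWords a, le x m := by
  have hlow : ∀ x ∈ omegaLimitWords a, ∀ s ∈ {b | ∃ N, IsSupOf le (tailsFrom a N) b}, le x s :=
    fun x hx s ⟨N, hs⟩ => h.le_of_mem_omegaLimitWords hx hs.1
  constructor
  · intro hm
    have hge : ∀ x ∈ omegaLimitWords a, le x m := fun x hx => hm.2 x (hlow x hx)
    obtain ⟨x, hx, hmx⟩ := h.exists_mem_omegaLimitWords_ge hm.1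
    obtain rfl := h.2.1 _ _ hmx (hge x hx)
    exact ⟨hx, hge⟩
  · rintro ⟨hm, hge⟩
    refine ⟨hlow m hm, fun c hc => ?_⟩
    obtain ⟨x, hx, hcx⟩ := h.exists_mem_omegaLimitWords_ge hc
    exact h.2.2.1 _ _ _ hcx (hge x hx)

end IsCylOrder

end Order

/-- Concatenation of the prefixes of `m` of lengths `f 0, f 1, …`. -/
theorem exists_concat_prefixes (m : ℕ → A) (f : ℕ → ℕ) :
    ∃ b : ℕ → A, ∀ i j, j < f i → b (∑ x ∈ Finset.range i, f x + j) = m j := by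
  have hmono : Monotone fun i => ∑ x ∈ Finset.range i, f x := fun i i' hi =>
    Finset.sum_le_sum_of_subset (Finset.range_subset_range.2 hi)
  have hlt : ∀ i i' j j', j < f i → ∑ x ∈ Finset.range i, f x + j =
      ∑ x ∈ Finset.range i', f x + j' → i' ≤ i := fun i i' j j' hj he => by
    by_contra! hi
    have := hmono (Nat.succ_le_of_lt hi)
    simp only [Nat.succ_eq_add_one, Finset.sum_range_succ] at this
    omega
  have hb : ∀ k, ∃ c, ∀ i j, j < f i → k = ∑ x ∈ Finset.range i, f x + j → c = m j := fun k => by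
    by_cases hk : ∃ i j, j < f i ∧ k = ∑ x ∈ Finset.range i, f x + j
    · obtain ⟨i, j, hj, rfl⟩ := hk
      refine ⟨m j, fun i' j' hj' he => ?_⟩
      obtain rfl := le_antisymm (hlt i' i j' j hj' he.symm) (hlt i i' j j' hj he)
      rw [Nat.add_left_cancel he]
    · exact ⟨m 0, fun i j hj he => (hk ⟨i, j, hj, he⟩).elim⟩
  choose b hb using hb
  exact ⟨b, fun i j hj => hb _ i j hj rfl⟩

theorem exists_eq_sum_range_add {f : ℕ → ℕ} (hf : ∀ i, 0 < f i) (k : ℕ) :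
    ∃ i j, j < f i ∧ k = ∑ x ∈ Finset.range i, f x + j := by
  induction k with
  | zero => exact ⟨0, 0, hf 0, by simp⟩
  | succ k ih =>
    obtain ⟨i, j, hj, rfl⟩ := ih
    by_cases hj' : j + 1 < f i
    · exact ⟨i, j + 1, hj', by omega⟩
    · exact ⟨i + 1, 0, hf _, by rw [Finset.sum_range_succ]; omega⟩

/-- A non-recurrent word has a longest prefix occurring infinitely often in it. -/
theorem exists_longest_recurrent_prefix {m : ℕ → A} (hm : m ∉ omegaLimitWords m) :
    ∃ L N, (∀ N', ∃ k, N' ≤ k ∧ ∀ i < L, m (i + k) = m i) ∧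
      ∀ k, N ≤ k → ¬ ∀ i < L + 1, m (i + k) = m i := by
  have hex : ∃ K, ¬ ∀ N, ∃ k, N ≤ k ∧ ∀ i < K, m (i + k) = m i := not_forall.1 hm
  obtain ⟨L, hL⟩ : ∃ L, Nat.find hex = L + 1 := by
    refine Nat.exists_eq_succ_of_ne_zero fun h0 => ?_
    have := Nat.find_spec hex
    rw [h0] at this
    exact this fun N => ⟨N, le_rfl, fun i hi => absurd hi (Nat.not_lt_zero i)⟩
  have hspec := Nat.find_spec hex
  rw [hL] at hspec
  push Not at hspec
  obtain ⟨N, hN⟩ := hspec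
  refine ⟨L, N, not_not.1 (Nat.find_min hex (m := L) (by omega)), fun k hk hall => ?_⟩
  obtain ⟨i, hi, hne⟩ := hN k hk
  exact hne (hall i hi)

/-- A word dominating all its tails is the greatest element of some ω-limit set.
If it is not recurrent, concatenate longer and longer prefixes of it, each cut just before an
occurrence of its longest recurrent prefix. -/
theorem exists_greatest_omegaLimitWords [DecidableEq A] {le : (ℕ → A) → (ℕ → A) → Prop}
    (h : IsCylOrder le) {m : ℕ → A} (hm : ∀ k, le (shiftn m k) m) :
    ∃ b, m ∈ omegaLimitWords b ∧ ∀ x ∈ omegaLimitWords b, le x m := by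
  by_cases hrec : m ∈ omegaLimitWords m
  · exact ⟨m, hrec, fun x hx => h.le_of_mem_omegaLimitWords (N := 0) hx
      fun _ ⟨k, _, hk⟩ => hk ▸ hm k⟩
  obtain ⟨L, N, hL, hN⟩ := exists_longest_recurrent_prefix hrec
  choose f hf hfL using fun i => hL (i + L + 1)
  obtain ⟨b, hb⟩ := exists_concat_prefixes m f
  set p : ℕ → ℕ := fun i => ∑ x ∈ Finset.range i, f x with hp
  have hp_succ : ∀ i, p (i + 1) = p i + f i := fun i => Finset.sum_range_succ f i
  have hp_mono : Monotone p := monotone_nat_of_le_succ fun i => by rw [hp_succ]; omega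
  have hp_ge : ∀ i, i ≤ p i := fun i => by
    induction i with
    | zero => exact Nat.zero_le _
    | succ i ih => have := hf i; rw [hp_succ]; omega
  have hbL : ∀ i j, j < f i + L → b (p i + j) = m j := fun i j hj => by
    rcases lt_or_ge j (f i) with hji | hji
    · exact hb i j hji
    · obtain ⟨r, rfl⟩ := Nat.exists_eq_add_of_le hji
      have := hb (i + 1) r (by have := hf (i + 1); omega)
      rw [← add_assoc, ← hp_succ, add_comm (f i) r, hfL i r (by omega)]
      exact this
  have key : ∀ K k, p (N + K) ≤ k → (∀ i < K, b (i + k) = m i) ∨ le (shiftn b k) m := by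
    intro K k hk
    obtain ⟨i, j, hj, hkij⟩ := exists_eq_sum_range_add (f := f) (fun i => by have := hf i; omega) k
    change k = p i + j at hkij
    have hi : N + K ≤ i := by
      by_contra! hlt
      have := hp_mono (Nat.succ_le_of_lt hlt)
      rw [Nat.succ_eq_add_one, hp_succ] at this
      omega
    have hfi := hf i
    have hagree : ∀ t < f i - j + L, shiftn m j t = shiftn b k t := fun t ht => by
      change m (t + j) = b (t + k)
      rw [show t + k = p i + (t + j) by omega, hbL i (t + j) (by omega)]
    by_cases hpre : ∀ t < f i - j + L, shiftn m j t = m t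
    · left
      have hjN : j < N := by
        by_contra! hge
        exact hN j hge fun t ht => hpre t (by omega)
      intro t ht
      exact (hagree t (by omega)).symm.trans (hpre t (by omega))
    · right
      push Not at hpre
      exact h.le_congr_left hagree hpre (hm j)
  refine ⟨b, fun K M => ⟨p (M + K), (Nat.le_add_right M K).trans (hp_ge _), fun i hi => ?_⟩,
    fun x hx => ?_⟩
  · rw [add_comm i]
    exact hb _ _ (by have := hf (M + K); omega)
  · by_cases hxm : x = m
    · exact hxm ▸ h.le_refl x
    obtain ⟨i, hi⟩ := Function.ne_iff.1 hxm
    obtain ⟨k, hk, hbk⟩ := hx (i + 1) (p (N + (i + 1)))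
    rcases key (i + 1) k hk with hpre | hle
    · exact absurd ((hbk i (by omega)).symm.trans (hpre i (by omega))) hi
    · exact h.le_congr_left hbk ⟨i, by omega, (hbk i (by omega)).trans_ne hi⟩ hle

theorem limsupWords_subset_supWords [Finite A] [DecidableEq A]
    {le : (ℕ → A) → (ℕ → A) → Prop} (h : IsCylOrder le) : limsupWords le ⊆ supWords le := by
  rintro m ⟨a, ha⟩
  obtain ⟨hm, hge⟩ := h.isLimsupOf_iff.1 ha
  exact ⟨m, fun _ ⟨k, hk⟩ => hk ▸ hge _ (shiftn_mem_omegaLimitWords hm k), fun _ hb => hb m ⟨0, rfl⟩⟩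

theorem supWords_subset_limsupWords [Finite A] [DecidableEq A]
    {le : (ℕ → A) → (ℕ → A) → Prop} (h : IsCylOrder le) : supWords le ⊆ limsupWords le := by
  rintro m ⟨a, ha⟩
  obtain ⟨s, hs, hsa⟩ := h.exists_isSupOf (S := tails a) ⟨a, 0, rfl⟩
  obtain rfl := h.isSupOf_unique hs ha
  rcases mem_omegaLimitWords_or_eq_shiftn hsa with hω | ⟨k, rfl⟩
  · exact ⟨a, h.isLimsupOf_iff.2 ⟨hω, fun x hx =>
      h.le_of_mem_omegaLimitWords (N := 0) hx fun _ ⟨k, _, hk⟩ => ha.1 _ ⟨k, hk⟩⟩⟩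
  · obtain ⟨b, hb⟩ := exists_greatest_omegaLimitWords h (m := shiftn a k) fun j =>
      ha.1 _ ⟨j + k, funext fun n => congrArg a (add_assoc n j k)⟩
    exact ⟨b, h.isLimsupOf_iff.2 hb⟩

end CylinderOrder

/-- For every cylinder order `≤` on `A^∞`, `L_≤ = M_≤`. -/
theorem stmt_2 {A : Type*} [Fintype A] [DecidableEq A]
    (le : (ℕ → A) → (ℕ → A) → Prop) (h : IsCylOrder le) :
    limsupWords le = supWords le :=
  (limsupWords_subset_supWords h).antisymm (supWords_subset_limsupWords h)
end
end

section
/- Let ≤ be a cylinder order on {0,1}^∞ with [0] < [1]. Suppose there exist 0 ≤ j < k with [10^j 1] < [10^j 0] and [10^k 1] < [10^k 0]; choose j minimal with [10^j 1] < [10^j 0] and then k > j minimal with [10^k 1] < [10^k 0]. Define ⪯ on {0,1}^∞ by a ⪯ b iff τ_{j,k}(a) ≤ τ_{j,k}(b). Then ⪯ is a cylinder order with [0] ≺ [1], m_≤ = τ_{j,k}(m_⪯), and {a ∈ M_≤ : a < m_≤} = {0^∞} ∪ {τ_{j,k}(a) : a ∈ M_⪯, a ≺ m_⪯}. -/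
open scoped Classical

noncomputable section

/-- Infinite binary words. -/
abbrev W2 := ℕ → Bool

/-- The word `0^∞`. -/
def w0 : W2 := fun _ => false

/-- The word `1^∞`. -/
def w1 : W2 := fun _ => true

/-- The word `10^∞`. -/
def w10inf : W2 := fun n => decide (n = 0)

/-- The periodic word `w^∞` for a finite word `w`. -/
def perW (w : List Bool) : W2 := fun n => w.getD (n % w.length) false

/-- A substitution on `{0,1}`, given by the images of the two letters. -/
abbrev Sub2 := Bool → List Bool

/-- Action of a substitution on finite words. -/
def listApply (f : Sub2) (l : List Bool) : List Bool := (l.map f).flatten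

/-- Action of a (nonerasing) substitution on infinite words. -/
def subApply (f : Sub2) (a : W2) : W2 :=
  fun n => (listApply f (List.ofFn (fun i : Fin (n + 1) => a i.val))).getD n false

/-- The substitution `τ_{j,k} : 0 ↦ 10^j, 1 ↦ 10^k`. -/
def tauS (j k : ℕ) : Sub2 := fun b => true :: List.replicate (if b then k else j) false

/-- Membership in the set `S = {τ_{j,k} : 0 ≤ j < k}`. -/
def memS (f : Sub2) : Prop := ∃ j k : ℕ, j < k ∧ f = tauS j k

/-- Apply a finite composition `σ_1 ∘ ⋯ ∘ σ_n` (given as a list) to an infinite word. -/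
def applyList (L : List Sub2) (a : W2) : W2 := L.foldr subApply a

/-- Apply a finite composition `σ_1 ∘ ⋯ ∘ σ_n` (given as a list) to a finite word. -/
def listApplyL (L : List Sub2) (l : List Bool) : List Bool := L.foldr listApply l

/-- `σ_{[1,n]} = σ_1 ∘ ⋯ ∘ σ_n` applied to an infinite word, for `σ ∈ S^∞`
(indexed from 0 in Lean). -/
def compUpTo (σ : ℕ → Sub2) (n : ℕ) (a : W2) : W2 :=
  applyList (List.ofFn (fun i : Fin n => σ i.val)) a

/-- `m` is the limit word `lim_{n → ∞} σ_{[1,n]}(a)`. -/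
def IsLimitWord (σ : ℕ → Sub2) (a m : W2) : Prop :=
  ∀ ε : ℝ, 0 < ε → ∃ N : ℕ, ∀ n ≥ N, wdist (compUpTo σ n a) m < ε

/-- The finite word `10^j b`. -/
def wordTenJ (j : ℕ) (b : Bool) : List Bool := true :: (List.replicate j false ++ [b])

section CylinderOrders

variable {A : Type*}

theorem shiftn_shiftn (a : ℕ → A) (p q : ℕ) : shiftn (shiftn a p) q = shiftn a (p + q) := by
  funext n
  simp only [shiftn]
  congr 1
  omega

theorem shiftn_zero (a : ℕ → A) : shiftn a 0 = a := rfl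

theorem mem_closure_iff_agree [TopologicalSpace A] [DiscreteTopology A]
    {s : Set (ℕ → A)} {x : ℕ → A} :
    x ∈ closure s ↔ ∀ n, ∃ y ∈ s, ∀ i < n, x i = y i := by
  rw [(PiNat.isTopologicalBasis_cylinders (fun _ : ℕ => A)).mem_closure_iff]
  constructor
  · intro h n
    obtain ⟨y, hy, hys⟩ := h _ ⟨x, n, rfl⟩ (PiNat.self_mem_cylinder x n)
    exact ⟨y, hys, fun i hi => (hy i hi).symm⟩
  · rintro h _ ⟨z, n, rfl⟩ hx
    obtain ⟨y, hys, hy⟩ := h n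
    exact ⟨y, fun i hi => (hy i hi).symm.trans (hx i hi), hys⟩

theorem shiftn_mem_closure_tails [TopologicalSpace A] [DiscreteTopology A]
    {a x : ℕ → A} (hx : x ∈ closure (tails a)) (p : ℕ) :
    shiftn x p ∈ closure (tails a) := by
  rw [mem_closure_iff_agree] at hx ⊢
  intro n
  obtain ⟨_, ⟨q, rfl⟩, hy⟩ := hx (n + p)
  exact ⟨_, ⟨q + p, rfl⟩, fun i hi => by
    rw [← shiftn_shiftn]
    exact hy (i + p) (by omega)⟩

variable [DecidableEq A]

theorem wdist_lt_pow_iff (a b : ℕ → A) (n : ℕ) :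
    wdist a b < (2 : ℝ)⁻¹ ^ n ↔ ∀ i < n, a i = b i := by
  unfold wdist
  split_ifs with h
  · rw [pow_lt_pow_iff_right_of_lt_one₀ (by norm_num) (by norm_num), Nat.lt_succ_iff,
      Nat.le_find_iff]
    simp
  · push Not at h
    simp [h]

theorem exists_first_diff {a b : ℕ → A} (h : a ≠ b) :
    ∃ n, (∀ i < n, a i = b i) ∧ a n ≠ b n := by
  have h' : ∃ n, a n ≠ b n := Function.ne_iff.mp h
  exact ⟨Nat.find h', fun i hi => not_not.mp (Nat.find_min h' hi), Nat.find_spec h'⟩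

theorem wdist_le_wdist_iff (a b c : ℕ → A) :
    wdist a b ≤ wdist a c ↔ ∀ n, (∀ i < n, a i = c i) → ∀ i < n, a i = b i := by
  constructor
  · intro h n hn
    rw [← wdist_lt_pow_iff] at hn ⊢
    exact h.trans_lt hn
  · intro h
    by_contra! hlt
    have hd : ∃ n, a n ≠ b n := by
      by_contra hne
      have h0 : wdist a b = 0 := by simp [wdist, hne]
      have h1 : 0 ≤ wdist a c := by unfold wdist; split_ifs <;> positivity
      linarith
    have hab : wdist a b = (2 : ℝ)⁻¹ ^ (Nat.find hd + 1) := by simp [wdist, hd]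
    rw [hab, wdist_lt_pow_iff] at hlt
    exact Nat.find_spec hd (h _ hlt _ (Nat.lt_succ_self _))

theorem isAccPt'_iff (M : Set (ℕ → A)) (x : ℕ → A) :
    IsAccPt' M x ↔ ∀ n, ∃ y ∈ M, y ≠ x ∧ ∀ i < n, x i = y i := by
  constructor
  · intro h n
    obtain ⟨y, hy, hne, hd⟩ := h ((2 : ℝ)⁻¹ ^ n) (by positivity)
    exact ⟨y, hy, hne, (wdist_lt_pow_iff _ _ _).mp hd⟩
  · intro h ε hε
    obtain ⟨n, hn⟩ := exists_pow_lt_of_lt_one hε (show (2 : ℝ)⁻¹ < 1 by norm_num)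
    obtain ⟨y, hy, hne, hd⟩ := h n
    exact ⟨y, hy, hne, ((wdist_lt_pow_iff _ _ _).mpr hd).trans hn⟩

variable {le : (ℕ → A) → (ℕ → A) → Prop}

theorem IsCylOrder.refl (h : IsCylOrder le) (a : ℕ → A) : le a a := (h.1 a a).elim id id

theorem IsCylOrder.convex (h : IsCylOrder le) {a b c : ℕ → A} (hab : le a b) (hbc : le b c)
    {n : ℕ} (hac : ∀ i < n, a i = c i) : ∀ i < n, a i = b i :=
  (wdist_le_wdist_iff a b c).mp (h.2.2.2 a b c hab hbc) n hac

/-- The comparison of two words depends only on prefixes that distinguish them. -/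
theorem IsCylOrder.le_of_agree (h : IsCylOrder le) {a b a' b' : ℕ → A} {n : ℕ} (hab : le a b)
    (hn : a n ≠ b n) (ha : ∀ i ≤ n, a i = a' i) (hb : ∀ i ≤ n, b i = b' i) : le a' b' := by
  by_contra hlt
  have hba' : le b' a' := (h.1 a' b').resolve_left hlt
  rcases h.1 a' b with h1 | h1
  · have := h.convex (n := n + 1) hba' h1 (fun i hi => (hb i (by omega)).symm) n (by omega)
    exact hn (by rw [ha n le_rfl, hb n le_rfl, this])
  · exact hn (h.convex (n := n + 1) hab h1 (fun i hi => ha i (by omega)) n (by omega))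

variable [TopologicalSpace A] [DiscreteTopology A]

theorem IsCylOrder.isClosed_setOf_le (h : IsCylOrder le) (b : ℕ → A) :
    IsClosed {x | le x b} := by
  refine isClosed_of_closure_subset fun x hx => ?_
  rw [mem_closure_iff_agree] at hx
  by_contra hlt
  have hbx : le b x := (h.1 x b).resolve_left hlt
  obtain ⟨n, -, hn⟩ := exists_first_diff (a := b) (b := x) (fun e => hlt (e ▸ h.refl b))
  obtain ⟨y, hy, hxy⟩ := hx (n + 1)
  have hby := h.le_of_agree hbx hn (fun _ _ => rfl) (fun i hi => hxy i (by omega))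
  exact hn (by rw [hxy n (by omega), h.2.1 b y hby hy])

theorem IsCylOrder.isClosed_setOf_ge (h : IsCylOrder le) (b : ℕ → A) :
    IsClosed {x | le b x} :=
  IsCylOrder.isClosed_setOf_le (le := fun x y => le y x)
    ⟨fun a b => h.1 b a, fun a b h1 h2 => h.2.1 a b h2 h1, fun a b c h1 h2 => h.2.2.1 c b a h2 h1,
      fun a b c h1 h2 => by
        rw [wdist_le_wdist_iff]
        intro n hac i hi
        rw [hac i hi]
        exact h.convex h2 h1 (fun i hi => (hac i hi).symm) i hi⟩ b

theorem IsCylOrder.exists_greatest (h : IsCylOrder le) [Finite A] {s : Set (ℕ → A)}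
    (hs : IsClosed s) (hne : s.Nonempty) : ∃ g ∈ s, ∀ x ∈ s, le x g := by
  have : Nonempty s := hne.to_subtype
  obtain ⟨g, hg⟩ := IsCompact.nonempty_iInter_of_directed_nonempty_isCompact_isClosed
    (fun y : s => s ∩ {x | le y.1 x})
    (fun x y => by
      rcases h.1 x.1 y.1 with hxy | hxy
      · exact ⟨y, fun z hz => ⟨hz.1, h.2.2.1 _ _ _ hxy hz.2⟩, fun z hz => hz⟩
      · exact ⟨x, fun z hz => hz, fun z hz => ⟨hz.1, h.2.2.1 _ _ _ hxy hz.2⟩⟩)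
    (fun y => ⟨y.1, y.2, h.refl _⟩)
    (fun y => (hs.inter (h.isClosed_setOf_ge y.1)).isCompact)
    (fun y => hs.inter (h.isClosed_setOf_ge y.1))
  rw [Set.mem_iInter] at hg
  exact ⟨g, (hg (Classical.arbitrary s)).1, fun x hx => (hg ⟨x, hx⟩).2⟩

/-- Sup-words are exactly the words that dominate all of their tails. -/
theorem IsCylOrder.mem_supWords_iff (h : IsCylOrder le) [Finite A] {m : ℕ → A} :
    m ∈ supWords le ↔ ∀ n, le (shiftn m n) m := by
  constructor
  · rintro ⟨a, hub, hlub⟩ n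
    obtain ⟨g, hg, hmax⟩ := h.exists_greatest (isClosed_closure (s := tails a))
      ⟨a, subset_closure ⟨0, rfl⟩⟩
    have hcl : ∀ x ∈ closure (tails a), le x m :=
      closure_minimal hub (h.isClosed_setOf_le m)
    have hgm : m = g :=
      h.2.1 _ _ (hlub g fun x hx => hmax x (subset_closure hx)) (hcl g hg)
    exact hcl _ (shiftn_mem_closure_tails (hgm ▸ hg) n)
  · intro hm
    refine ⟨m, ?_, fun b hb => hb m ⟨0, rfl⟩⟩
    rintro _ ⟨n, rfl⟩
    exact hm n

end CylinderOrders

section Substitution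

variable {j k : ℕ}

/-- The length of the image of a letter under `τ_{j,k}`. -/
def tauLen (j k : ℕ) (b : Bool) : ℕ := (if b then k else j) + 1

/-- The length of the image under `τ_{j,k}` of the prefix of length `n`. -/
def tauPos (j k : ℕ) (a : W2) (n : ℕ) : ℕ := ∑ i ∈ Finset.range n, tauLen j k (a i)

theorem length_tauS (b : Bool) : (tauS j k b).length = tauLen j k b := by
  simp [tauS, tauLen]

theorem lt_tauLen (hjk : j < k) (b : Bool) : j < tauLen j k b := by
  cases b <;> grind [tauLen]

theorem listApply_ofFn_succ (f : Sub2) (a : W2) (n : ℕ) :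
    listApply f (List.ofFn (fun i : Fin (n + 1) => a i.val)) =
      f (a 0) ++ listApply f (List.ofFn (fun i : Fin n => shiftn a 1 i.val)) := by
  simp [listApply, List.ofFn_succ, shiftn]

theorem listApply_tauS_getD_of_le (a : W2) {n p q : ℕ} (hp : n < p) (hpq : p ≤ q) :
    (listApply (tauS j k) (List.ofFn (fun i : Fin p => a i.val))).getD n false =
      (listApply (tauS j k) (List.ofFn (fun i : Fin q => a i.val))).getD n false := by
  induction p generalizing a n q with
  | zero => omega
  | succ p ih =>
    obtain ⟨q, rfl⟩ : ∃ r, q = r + 1 := ⟨q - 1, by omega⟩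
    rw [listApply_ofFn_succ, listApply_ofFn_succ]
    by_cases hn : n < (tauS j k (a 0)).length
    · rw [List.getD_append _ _ _ _ hn, List.getD_append _ _ _ _ hn]
    · rw [List.getD_append_right _ _ _ _ (by omega), List.getD_append_right _ _ _ _ (by omega)]
      have h1 : 1 ≤ (tauS j k (a 0)).length := by simp [tauS]
      exact ih _ (by omega) (by omega)

theorem subApply_tauS_of_lt (a : W2) {n : ℕ} (hn : n < tauLen j k (a 0)) :
    subApply (tauS j k) a n = decide (n = 0) := by
  unfold subApply
  rw [listApply_ofFn_succ, List.getD_append _ _ _ _ (by rwa [length_tauS])]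
  cases n with
  | zero => simp [tauS]
  | succ n => simp [tauS]

theorem subApply_tauS_add (a : W2) (n : ℕ) :
    subApply (tauS j k) a (n + tauLen j k (a 0)) = subApply (tauS j k) (shiftn a 1) n := by
  unfold subApply
  rw [listApply_ofFn_succ, List.getD_append_right _ _ _ _ (by rw [length_tauS]; omega),
    length_tauS, Nat.add_sub_cancel]
  symm
  exact listApply_tauS_getD_of_le _ (by omega) (by simp only [tauLen]; omega)

theorem shiftn_subApply_tauS (a : W2) :
    shiftn (subApply (tauS j k) a) (tauLen j k (a 0)) = subApply (tauS j k) (shiftn a 1) :=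
  funext fun n => subApply_tauS_add a n

theorem subApply_tauS_zero (a : W2) : subApply (tauS j k) a 0 = true := by
  rw [subApply_tauS_of_lt a (by simp [tauLen])]
  simp

theorem tauPos_succ (a : W2) (n : ℕ) :
    tauPos j k a (n + 1) = tauPos j k (shiftn a 1) n + tauLen j k (a 0) := by
  rw [tauPos, Finset.sum_range_succ']
  rfl

theorem tauPos_strictMono (a : W2) : StrictMono (tauPos j k a) := by
  refine strictMono_nat_of_lt_succ fun n => ?_
  rw [tauPos, tauPos, Finset.sum_range_succ]
  simp [tauLen]

theorem subApply_tauS_agree (hjk : j < k) {a b : W2} {n : ℕ} (hab : ∀ i < n, a i = b i) :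
    ∀ i < tauPos j k a n + j + 1, subApply (tauS j k) a i = subApply (tauS j k) b i := by
  induction n generalizing a b with
  | zero =>
    intro i hi
    simp only [tauPos, Finset.range_zero, Finset.sum_empty] at hi
    rw [subApply_tauS_of_lt a (by have := lt_tauLen hjk (a 0); omega),
      subApply_tauS_of_lt b (by have := lt_tauLen hjk (b 0); omega)]
  | succ n ih =>
    intro i hi
    have h0 : a 0 = b 0 := hab 0 (by omega)
    rw [tauPos_succ] at hi
    by_cases hlt : i < tauLen j k (a 0)
    · rw [subApply_tauS_of_lt a hlt, subApply_tauS_of_lt b (h0 ▸ hlt)]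
    · obtain ⟨i, rfl⟩ := Nat.exists_eq_add_of_le' (not_lt.mp hlt)
      rw [subApply_tauS_add, h0, subApply_tauS_add]
      exact ih (a := shiftn a 1) (fun i hi => hab (i + 1) (by omega)) i (by omega)

theorem subApply_tauS_succ (hjk : j < k) (a : W2) :
    subApply (tauS j k) a (j + 1) = !a 0 := by
  cases h : a 0 with
  | false =>
    have := subApply_tauS_add (j := j) (k := k) a 0
    simpa [tauLen, h, subApply_tauS_zero] using this
  | true =>
    rw [subApply_tauS_of_lt a (by simpa [tauLen, h] using hjk)]
    simp

theorem subApply_tauS_diff (hjk : j < k) {a b : W2} {n : ℕ} (hab : ∀ i < n, a i = b i)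
    (hn : a n ≠ b n) : subApply (tauS j k) a (tauPos j k a n + j + 1) ≠
      subApply (tauS j k) b (tauPos j k a n + j + 1) := by
  induction n generalizing a b with
  | zero =>
    simpa [tauPos, subApply_tauS_succ hjk] using hn
  | succ n ih =>
    have h0 : a 0 = b 0 := hab 0 (by omega)
    rw [tauPos_succ, show tauPos j k (shiftn a 1) n + tauLen j k (a 0) + j + 1 =
      tauPos j k (shiftn a 1) n + j + 1 + tauLen j k (a 0) by omega, subApply_tauS_add, h0,
      subApply_tauS_add]
    exact ih (fun i hi => hab (i + 1) (by omega)) hn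

theorem subApply_tauS_injective (hjk : j < k) : Function.Injective (subApply (tauS j k)) := by
  intro a b hab
  by_contra hne
  obtain ⟨n, h1, h2⟩ := exists_first_diff hne
  exact subApply_tauS_diff hjk h1 h2 (congrFun hab _)

/-- A long enough common prefix of the images forces a given common prefix of the preimages. -/
theorem agree_of_subApply_tauS_agree (hjk : j < k) {a b : W2} {n : ℕ}
    (hab : ∀ i < tauPos j k a n + j + 1, subApply (tauS j k) a i = subApply (tauS j k) b i) :
    ∀ i < n, a i = b i := by
  intro i hi
  by_contra hne
  obtain ⟨q, h1, h2⟩ : ∃ q, (∀ i < q, a i = b i) ∧ a q ≠ b q :=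
    exists_first_diff (fun e => hne (congrFun e i))
  have hqi : q ≤ i := by
    by_contra hlt
    exact hne (h1 i (by omega))
  have := tauPos_strictMono (j := j) (k := k) a (lt_of_le_of_lt hqi hi)
  exact subApply_tauS_diff hjk h1 h2 (hab _ (by omega))

theorem continuous_subApply_tauS (hjk : j < k) : Continuous (subApply (tauS j k)) := by
  refine continuous_iff_continuousAt.mpr fun a => ?_
  refine tendsto_pi_nhds.mpr fun n => tendsto_nhds_of_eventually_eq ?_
  filter_upwards [(PiNat.isOpen_cylinder (fun _ : ℕ => Bool) a n).mem_nhds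
    (PiNat.self_mem_cylinder a n)] with b hb
  have := (tauPos_strictMono (j := j) (k := k) a).le_apply (x := n)
  exact (subApply_tauS_agree hjk (fun i hi => (hb i hi).symm) n (by omega)).symm

theorem exists_subApply_tauS_shiftn_eq (a : W2) (n : ℕ) :
    ∃ p, subApply (tauS j k) (shiftn a n) = shiftn (subApply (tauS j k) a) p := by
  induction n generalizing a with
  | zero => exact ⟨0, rfl⟩
  | succ n ih =>
    obtain ⟨p, hp⟩ := ih (shiftn a 1)
    rw [← shiftn_subApply_tauS, shiftn_shiftn, shiftn_shiftn, Nat.add_comm 1] at hp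
    exact ⟨_, hp⟩

theorem shiftn_subApply_tauS_cases (a : W2) (p : ℕ) :
    shiftn (subApply (tauS j k) a) p 0 = false ∨
      ∃ n, shiftn (subApply (tauS j k) a) p = subApply (tauS j k) (shiftn a n) := by
  induction p using Nat.strong_induction_on generalizing a with
  | _ p ih =>
    rcases Nat.eq_zero_or_pos p with rfl | hp
    · exact Or.inr ⟨0, rfl⟩
    by_cases hlt : p < tauLen j k (a 0)
    · left
      simp only [shiftn, Nat.zero_add]
      rw [subApply_tauS_of_lt a hlt]
      simp [hp.ne']
    · obtain ⟨q, rfl⟩ := Nat.exists_eq_add_of_le (not_lt.mp hlt)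
      rw [← shiftn_shiftn, shiftn_subApply_tauS]
      rcases ih q (by simp only [tauLen]; omega) (shiftn a 1) with h | ⟨n, h⟩
      · exact Or.inl h
      · exact Or.inr ⟨1 + n, by rw [h, shiftn_shiftn]⟩

/-- Unfolded membership in the cylinder of `10^i b`. -/
def StartsTen (i : ℕ) (b : Bool) (z : W2) : Prop :=
  z 0 = true ∧ (∀ p < i, z (p + 1) = false) ∧ z (i + 1) = b

theorem inCyl_wordTenJ_iff (i : ℕ) (b : Bool) (z : W2) :
    inCyl (wordTenJ i b) z ↔ StartsTen i b z := by
  have hlen : (wordTenJ i b).length = i + 2 := by simp [wordTenJ]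
  have hget : inCyl (wordTenJ i b) z ↔ ∀ p < i + 2, z p = (wordTenJ i b).getD p false := by
    constructor
    · intro h p hp
      have h1 := h ⟨p, by omega⟩
      rw [h1, List.getD_eq_getElem _ _ (by omega)]
      rfl
    · intro h p
      have hp := p.2
      rw [h p.1 (by omega), List.getD_eq_getElem _ _ hp]
      rfl
  rw [hget]
  constructor
  · intro h
    refine ⟨by simpa [wordTenJ] using h 0 (by omega), fun p hp => ?_, ?_⟩
    · rw [h (p + 1) (by omega)]
      simp only [wordTenJ, List.getD_cons_succ]
      rw [List.getD_append _ _ _ _ (by simpa using hp)]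
      simp
    · rw [h (i + 1) (by omega)]
      simp only [wordTenJ, List.getD_cons_succ]
      rw [List.getD_append_right _ _ _ _ (by simp)]
      simp
  · rintro ⟨h0, h1, h2⟩ p hp
    rcases p with _ | p
    · simpa [wordTenJ] using h0
    simp only [wordTenJ, List.getD_cons_succ]
    by_cases hpi : p < i
    · rw [h1 p hpi, List.getD_append _ _ _ _ (by simpa using hpi)]
      simp
    · obtain rfl : p = i := by omega
      rw [h2, List.getD_append_right _ _ _ _ (by simp)]
      simp

/-- Membership in `[10^j 1] ∪ [10^k 1]`. -/
def StartsBlock (j k : ℕ) (z : W2) : Prop := StartsTen j true z ∨ StartsTen k true z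

theorem subApply_tauS_startsTen (a : W2) :
    StartsTen (if a 0 then k else j) true (subApply (tauS j k) a) := by
  refine ⟨subApply_tauS_zero a, fun p hp => ?_, ?_⟩
  · rw [subApply_tauS_of_lt a (by simp only [tauLen]; omega)]
    simp
  · have := subApply_tauS_add (j := j) (k := k) a 0
    rwa [Nat.zero_add, subApply_tauS_zero] at this

theorem startsBlock_subApply_tauS (a : W2) : StartsBlock j k (subApply (tauS j k) a) := by
  have h := subApply_tauS_startsTen (j := j) (k := k) a
  split_ifs at h
  · exact Or.inr h
  · exact Or.inl h

/-- The first letter of the `τ_{j,k}`-preimage of a word. -/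
def tauHead (j : ℕ) (x : W2) : Bool := !x (j + 1)

/-- Removal of the first `τ_{j,k}`-block of a word. -/
def tauDrop (j k : ℕ) (x : W2) : W2 := shiftn x (tauLen j k (tauHead j x))

/-- The `τ_{j,k}`-preimage of a word. -/
def tauDecode (j k : ℕ) (x : W2) : W2 := fun n => tauHead j ((tauDrop j k)^[n] x)

theorem shiftn_tauDecode (x : W2) :
    shiftn (tauDecode j k x) 1 = tauDecode j k (tauDrop j k x) := rfl

theorem StartsBlock.startsTen_tauHead (hjk : j < k) {x : W2} (hx : StartsBlock j k x) :
    StartsTen (if tauHead j x then k else j) true x := by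
  rcases hx with hx | hx
  · simpa [tauHead, hx.2.2] using hx
  · simpa [tauHead, hx.2.1 j hjk] using hx

theorem subApply_tauDecode (hjk : j < k) {x : W2} (h0 : x 0 = true)
    (hx : ∀ n, x n = true → StartsBlock j k (shiftn x n)) :
    subApply (tauS j k) (tauDecode j k x) = x := by
  funext i
  induction i using Nat.strong_induction_on generalizing x with
  | _ i ih =>
    have hb := (hx 0 h0).startsTen_tauHead hjk
    rw [shiftn_zero] at hb
    have hhead : tauDecode j k x 0 = tauHead j x := rfl
    by_cases hlt : i < tauLen j k (tauHead j x)
    · rw [subApply_tauS_of_lt _ hlt]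
      rcases i with _ | i
      · simp [h0]
      · rw [hb.2.1 i (by simp only [tauLen] at hlt; omega)]
        simp
    · obtain ⟨q, rfl⟩ := Nat.exists_eq_add_of_le' (not_lt.mp hlt)
      rw [← hhead, subApply_tauS_add, shiftn_tauDecode,
        ih q (by simp only [tauLen]; omega) (x := tauDrop j k x)]
      · rfl
      · simpa [tauDrop, shiftn, tauLen] using hb.2.2
      · intro n hn
        rw [tauDrop, shiftn_shiftn]
        exact hx _ (by rw [Nat.add_comm]; exact hn)

end Substitution

section Renormalization

variable {le : W2 → W2 → Prop} {j k : ℕ}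

theorem IsCylOrder.comp_subApply_tauS (h : IsCylOrder le) (hjk : j < k) :
    IsCylOrder fun a b => le (subApply (tauS j k) a) (subApply (tauS j k) b) := by
  refine ⟨fun a b => h.1 _ _, fun a b h1 h2 => subApply_tauS_injective hjk (h.2.1 _ _ h1 h2),
    fun a b c => h.2.2.1 _ _ _, fun a b c h1 h2 => ?_⟩
  rw [wdist_le_wdist_iff]
  exact fun n hac => agree_of_subApply_tauS_agree hjk
    (h.convex h1 h2 (subApply_tauS_agree hjk hac))

theorem wlt_of_zero_one (h01 : cylLt le [false] [true]) {a b : W2} (ha : a 0 = false)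
    (hb : b 0 = true) : wlt le a b :=
  h01 a b (fun i => by rw [Fin.fin_one_eq_zero i]; exact ha)
    (fun i => by rw [Fin.fin_one_eq_zero i]; exact hb)

theorem not_le_of_wlt (h : IsCylOrder le) {a b : W2} (hab : wlt le a b) : ¬ le b a :=
  fun hba => hab.2 (h.2.1 _ _ hab.1 hba)

theorem StartsTen.agree {i : ℕ} {b : Bool} {u v : W2} (hu : StartsTen i b u)
    (hv : StartsTen i b v) : ∀ p ≤ i + 1, u p = v p := by
  intro p hp
  rcases p with _ | p
  · rw [hu.1, hv.1]
  · by_cases hpi : p < i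
    · rw [hu.2.1 p hpi, hv.2.1 p hpi]
    · obtain rfl : p = i := by omega
      rw [hu.2.2, hv.2.2]

theorem IsCylOrder.wlt_of_not_cylLt (h : IsCylOrder le) {i : ℕ}
    (hi : ¬ cylLt le (wordTenJ i true) (wordTenJ i false)) {u z : W2}
    (hu : StartsTen i false u) (hz : StartsTen i true z) : wlt le u z := by
  simp only [cylLt, not_forall, inCyl_wordTenJ_iff] at hi
  obtain ⟨a, b, ha, hb, hab⟩ := hi
  have hne : b (i + 1) ≠ a (i + 1) := by simp [ha.2.2, hb.2.2]
  have hle : le b a := by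
    rcases h.1 b a with h1 | h1
    · exact h1
    · exact absurd ⟨h1, fun e => hne (by rw [e])⟩ hab
  refine ⟨h.le_of_agree hle hne (hb.agree hu) (ha.agree hz), fun e => ?_⟩
  have := hu.2.2
  rw [e, hz.2.2] at this
  exact absurd this (by simp)

theorem exists_startsTen_or (z : W2) (hz : z 0 = true) (k : ℕ) :
    (∃ i ≤ k, StartsTen i true z) ∨ StartsTen k false z := by
  by_cases hex : ∃ p, p ≤ k ∧ z (p + 1) = true
  · refine Or.inl ⟨Nat.find hex, (Nat.find_spec hex).1, hz, fun p hp => ?_,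
      (Nat.find_spec hex).2⟩
    have := Nat.find_min hex hp
    have hk := (Nat.find_spec hex).1
    simpa using fun e => this ⟨by omega, e⟩
  · push Not at hex
    exact Or.inr ⟨hz, fun p hp => by simpa using hex p hp.le, by simpa using hex k le_rfl⟩

/-- Within `[1]`, everything outside `[10^j 1] ∪ [10^k 1]` is larger than these cylinders. -/
theorem IsCylOrder.wlt_of_startsBlock (h : IsCylOrder le) (hjk : j < k)
    (hj : cylLt le (wordTenJ j true) (wordTenJ j false))
    (hjmin : ∀ i < j, ¬ cylLt le (wordTenJ i true) (wordTenJ i false))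
    (hk : cylLt le (wordTenJ k true) (wordTenJ k false))
    (hkmin : ∀ i, j < i → i < k → ¬ cylLt le (wordTenJ i true) (wordTenJ i false))
    {u z : W2} (hu : StartsBlock j k u) (hz0 : z 0 = true) (hz : ¬ StartsBlock j k z) :
    wlt le u z := by
  simp only [cylLt, inCyl_wordTenJ_iff] at hj hk
  have weaken {i l : ℕ} {b : Bool} {x : W2} (hil : i < l) (hx : StartsTen l b x) :
      StartsTen i false x := ⟨hx.1, fun p hp => hx.2.1 p (by omega), hx.2.1 i hil⟩
  rcases exists_startsTen_or z hz0 k with ⟨i, hik, hi⟩ | hzk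
  · rcases lt_trichotomy i j with hij | rfl | hij
    · refine h.wlt_of_not_cylLt (hjmin i hij) ?_ hi
      exact hu.elim (weaken hij) (weaken (hij.trans hjk))
    · exact absurd (Or.inl hi) hz
    · rcases hik.lt_or_eq with hik | rfl
      · rcases hu with hu | hu
        · exact hj _ _ hu (weaken hij hi)
        · exact h.wlt_of_not_cylLt (hkmin i hij hik) (weaken hik hu) hi
      · exact absurd (Or.inr hi) hz
  · rcases hu with hu | hu
    · exact hj _ _ hu (weaken hjk hzk)
    · exact hk _ _ hu hzk

theorem w0_mem_supWords (h : IsCylOrder le) : w0 ∈ supWords le :=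
  h.mem_supWords_iff.mpr fun _ => h.refl w0

theorem eq_w0_of_mem_supWords (h : IsCylOrder le) (h01 : cylLt le [false] [true]) {x : W2}
    (hx : x ∈ supWords le) (hx0 : x 0 = false) : x = w0 := by
  rw [h.mem_supWords_iff] at hx
  funext n
  by_contra hn
  have hn' : shiftn x n 0 = true := by simpa [shiftn, w0] using hn
  exact not_le_of_wlt h (wlt_of_zero_one h01 hx0 hn') (hx n)

theorem subApply_tauS_mem_supWords_iff (h : IsCylOrder le) (h01 : cylLt le [false] [true])
    (hjk : j < k) {y : W2} :
    subApply (tauS j k) y ∈ supWords le ↔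
      y ∈ supWords fun a b => le (subApply (tauS j k) a) (subApply (tauS j k) b) := by
  rw [h.mem_supWords_iff, (h.comp_subApply_tauS hjk).mem_supWords_iff]
  constructor
  · intro hy n
    obtain ⟨p, hp⟩ := exists_subApply_tauS_shiftn_eq (j := j) (k := k) y n
    rw [hp]
    exact hy p
  · intro hy p
    rcases shiftn_subApply_tauS_cases (j := j) (k := k) y p with hp | ⟨n, hn⟩
    · exact (wlt_of_zero_one h01 hp (subApply_tauS_zero y)).1
    · rw [hn]
      exact hy n

end Renormalization

/-- Let `≤` be a cylinder order on `{0,1}^∞` with `[0] < [1]`, let `j` be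
minimal with `[10^j 1] < [10^j 0]` and `k > j` minimal with `[10^k 1] < [10^k 0]`.
Define `a ⪯ b` iff `τ_{j,k}(a) ≤ τ_{j,k}(b)`. Then `⪯` is a cylinder order with
`[0] ≺ [1]`, `m_≤ = τ_{j,k}(m_⪯)`, and
`{a ∈ M_≤ : a < m_≤} = {0^∞} ∪ τ_{j,k}({a ∈ M_⪯ : a ≺ m_⪯})`. -/
theorem stmt_4 (le : W2 → W2 → Prop) (h : IsCylOrder le)
    (h01 : cylLt le [false] [true]) (j k : ℕ) (hjk : j < k)
    (hj : cylLt le (wordTenJ j true) (wordTenJ j false))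
    (hjmin : ∀ i < j, ¬ cylLt le (wordTenJ i true) (wordTenJ i false))
    (hk : cylLt le (wordTenJ k true) (wordTenJ k false))
    (hkmin : ∀ i, j < i → i < k → ¬ cylLt le (wordTenJ i true) (wordTenJ i false))
    (le' : W2 → W2 → Prop)
    (hle' : le' = fun a b => le (subApply (tauS j k) a) (subApply (tauS j k) b)) :
    IsCylOrder le' ∧ cylLt le' [false] [true] ∧
      ∀ m m', IsSmallestAcc le (supWords le) m → IsSmallestAcc le' (supWords le') m' →
        m = subApply (tauS j k) m' ∧
          {a ∈ supWords le | wlt le a m} =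
            insert w0 (subApply (tauS j k) '' {a ∈ supWords le' | wlt le' a m'}) := by
  subst hle'
  set T := subApply (tauS j k) with hT
  have hcyl : IsCylOrder fun a b => le (T a) (T b) := h.comp_subApply_tauS hjk
  have hblock {u z : W2} (hu : StartsBlock j k u) (hz0 : z 0 = true) (hz : ¬ StartsBlock j k z) :
      wlt le u z := h.wlt_of_startsBlock hjk hj hjmin hk hkmin hu hz0 hz
  have hrange {x : W2} (hx : x ∈ supWords le) (hxb : StartsBlock j k x) : ∃ y, T y = x := by
    have hx0 : x 0 = true := hxb.elim (·.1) (·.1)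
    refine ⟨tauDecode j k x, subApply_tauDecode hjk hx0 fun n hn => ?_⟩
    by_contra hnb
    exact not_le_of_wlt h (hblock hxb (by simpa [shiftn] using hn) hnb)
      (h.mem_supWords_iff.mp hx n)
  have hcases {x z : W2} (hxz : le x (T z)) : x 0 = false ∨ StartsBlock j k x := by
    by_contra! hx
    exact not_le_of_wlt h
      (hblock (startsBlock_subApply_tauS z) (by simpa using hx.1) hx.2) hxz
  refine ⟨hcyl, ?_, ?_⟩
  · intro a b ha hb
    have ha0 : a 0 = false := ha 0
    have hb0 : b 0 = true := hb 0
    have hlt := hj (T a) (T b)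
      ((inCyl_wordTenJ_iff _ _ _).mpr (by simpa [ha0] using subApply_tauS_startsTen (k := k) a))
      ((inCyl_wordTenJ_iff _ _ _).mpr ⟨subApply_tauS_zero b, fun p hp =>
        (by simpa [hb0] using subApply_tauS_startsTen (j := j) (k := k) b :
          StartsTen k true (T b)).2.1 p (by omega), by simp [hT, subApply_tauS_succ hjk, hb0]⟩)
    exact ⟨hlt.1, fun e => hlt.2 (by rw [e])⟩
  · rintro m m' ⟨hm, hmin⟩ ⟨hm', hmin'⟩
    rw [isAccPt'_iff] at hm hm'
    have hmle : le m (T m') := by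
      refine hmin _ ((isAccPt'_iff _ _).mpr fun n => ?_)
      obtain ⟨y, hy, hne, hag⟩ := hm' n
      refine ⟨T y, (subApply_tauS_mem_supWords_iff h h01 hjk).mpr hy,
        (subApply_tauS_injective hjk).ne hne, fun i hi => ?_⟩
      have := (tauPos_strictMono (j := j) (k := k) m').le_apply (x := n)
      exact subApply_tauS_agree hjk hag i (by omega)
    have hm0 : m 0 = true := by
      by_contra hm0
      obtain ⟨y, hy, hne, hag⟩ := hm 1
      have hy0 := eq_w0_of_mem_supWords h h01 hy (by rw [← hag 0 (by omega)]; simpa using hm0)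
      subst hy0
      obtain ⟨q, -, hq⟩ := exists_first_diff hne
      obtain ⟨z, hz, -, hag'⟩ := hm (q + 1)
      have hz0 := eq_w0_of_mem_supWords h h01 hz (by rw [← hag' 0 (by omega)]; simpa using hm0)
      exact hq (by rw [hag' q (by omega), hz0])
    have hmb : StartsBlock j k m := (hcases hmle).resolve_left (by simp [hm0])
    have hnear {n : ℕ} (hn : k + 2 ≤ n) :
        ∃ y ∈ supWords fun a b => le (T a) (T b), T y ≠ m ∧ ∀ i < n, m i = T y i := by
      obtain ⟨x, hx, hne, hag⟩ := hm n
      have hxb : StartsBlock j k x := by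
        refine hmb.imp (fun hs => ?_) (fun hs => ?_) <;>
        exact ⟨(hag _ (by omega)).symm.trans hs.1,
          fun p hp => (hag _ (by omega)).symm.trans (hs.2.1 p hp),
          (hag _ (by omega)).symm.trans hs.2.2⟩
      obtain ⟨y, rfl⟩ := hrange hx hxb
      exact ⟨y, (subApply_tauS_mem_supWords_iff h h01 hjk).mp hx, hne, hag⟩
    obtain ⟨z, rfl⟩ : m ∈ Set.range T := by
      rw [← (isCompact_range (continuous_subApply_tauS hjk)).isClosed.closure_eq,
        mem_closure_iff_agree]
      intro n
      obtain ⟨y, -, -, hag⟩ := hnear (n := n + k + 2) (by omega)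
      exact ⟨T y, ⟨y, rfl⟩, fun i hi => hag i (by omega)⟩
    have hzm : le (T m') (T z) := by
      refine hmin' z ((isAccPt'_iff _ _).mpr fun n => ?_)
      obtain ⟨y, hy, hne, hag⟩ := hnear (n := tauPos j k z n + j + k + 2) (by omega)
      exact ⟨y, hy, fun e => hne (by rw [e]),
        agree_of_subApply_tauS_agree hjk fun i hi => hag i (by omega)⟩
    have hTz : T z = T m' := h.2.1 _ _ hmle hzm
    refine ⟨hTz, Set.ext fun a => ?_⟩
    rw [hTz]
    constructor
    · rintro ⟨ha, hlt⟩
      rcases hcases hlt.1 with ha0 | hab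
      · exact Or.inl (eq_w0_of_mem_supWords h h01 ha ha0)
      · obtain ⟨y, rfl⟩ := hrange ha hab
        exact Or.inr ⟨y, ⟨(subApply_tauS_mem_supWords_iff h h01 hjk).mp ha, hlt.1,
          fun e => hlt.2 (by rw [e])⟩, rfl⟩
    · rintro (rfl | ⟨y, ⟨hy, hle, hne⟩, rfl⟩)
      · exact ⟨w0_mem_supWords h, wlt_of_zero_one h01 rfl (subApply_tauS_zero m')⟩
      · exact ⟨(subApply_tauS_mem_supWords_iff h h01 hjk).mpr hy, hle,
          (subApply_tauS_injective hjk).ne hne⟩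
end
end
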